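/- Let q be a prime power, K a finite field with q elements, K̄ an algebraic closure of K, and φ the Frobenius map on P¹(K̄) given by [a : b] ↦ [a^q : b^q]. The number of ordered 4-tuples (x₁, x₂, x₃, x₄) of pairwise distinct points of P¹(K̄) satisfying φ(x₁) = x₂, φ(x₂) = x₃, φ(x₃) = x₁ and φ(x₄) = x₄ equals (q + 1)(q³ − q). -/

import Mathlib

open Projectivization

/-- The Frobenius map on the projective line `P¹(L)`, acting in homogeneous coordinates by
`[a : b] ↦ [a ^ q : b ^ q]`. -/
noncomputable def frobP1 {L : Type*} [Field L] (q : ℕ)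
    (x : Projectivization L (Fin 2 → L)) : Projectivization L (Fin 2 → L) :=
  Projectivization.mk L (fun i => (x.rep i) ^ q) (by
    intro hzero
    obtain ⟨i, hi⟩ := Function.ne_iff.mp x.rep_nonzero
    have h2 : x.rep i ^ q = 0 := congrFun hzero i
    exact hi (by simpa using (pow_eq_zero_iff'.mp h2).1))

section FrobeniusPoints

open Polynomial in
/-- In an algebraically closed field of characteristic dividing `m`, the equation `a ^ m = a`
has `m` solutions. -/
theorem ncard_setOf_pow_eq_self {L : Type*} [Field L] [IsAlgClosed L] (p : ℕ) [CharP L p]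
    {m : ℕ} (hm : 1 < m) (hp : p ∣ m) : {a : L | a ^ m = a}.ncard = m := by
  have hne : (X ^ m - X : L[X]) ≠ 0 := FiniteField.X_pow_card_sub_X_ne_zero L hm
  have hset : {a : L | a ^ m = a} = (X ^ m - X : L[X]).rootSet L := by
    ext a
    simp [mem_rootSet, hne, sub_eq_zero]
  have hcard := card_rootSet_eq_natDegree (K := L) (galois_poly_separable (K := L) p m hp)
    (IsAlgClosed.splits _)
  rw [hset, ← Nat.card_coe_set_eq, Nat.card_eq_fintype_card, hcard,
    FiniteField.X_pow_card_sub_X_natDegree_eq L hm]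

variable {L : Type*} [Field L]

/-- The parametrization of the projective line by its affine chart and the point at infinity. -/
noncomputable def optionToP1 : Option L → Projectivization L (Fin 2 → L)
  | none => Projectivization.mk L ![1, 0] fun h => one_ne_zero (congrFun h 0)
  | some a => Projectivization.mk L ![a, 1] fun h => one_ne_zero (congrFun h 1)

theorem optionToP1_bijective : Function.Bijective (optionToP1 (L := L)) := by
  constructor
  · rintro (_ | a) (_ | b) h
    · rfl
    · obtain ⟨c, hc⟩ := (mk_eq_mk_iff' L _ _ _ _).1 h
      have h0 := congrFun hc 0
      have h1 := congrFun hc 1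
      simp_all
    · obtain ⟨c, hc⟩ := (mk_eq_mk_iff' L _ _ _ _).1 h
      have h1 := congrFun hc 1
      simp_all
    · obtain ⟨c, hc⟩ := (mk_eq_mk_iff' L _ _ _ _).1 h
      have h0 := congrFun hc 0
      have h1 := congrFun hc 1
      simp_all
  · intro x
    induction x using Projectivization.ind with
    | h v hv =>
      by_cases h1 : v 1 = 0
      · have h0 : v 0 ≠ 0 := fun h0 => hv (by ext i; fin_cases i <;> simp [h0, h1])
        refine ⟨none, (mk_eq_mk_iff' L _ _ _ _).2 ⟨(v 0)⁻¹, ?_⟩⟩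
        ext i; fin_cases i <;> simp [h0, h1]
      · refine ⟨some (v 0 / v 1), (mk_eq_mk_iff' L _ _ _ _).2 ⟨(v 1)⁻¹, ?_⟩⟩
        ext i; fin_cases i <;> simp [h1, div_eq_inv_mul]

theorem frobP1_mk (q : ℕ) {v w : Fin 2 → L} (hv : v ≠ 0) (hw : w ≠ 0)
    (h : ∀ i, v i ^ q = w i) :
    frobP1 q (Projectivization.mk L v hv) = Projectivization.mk L w hw := by
  obtain ⟨c, hc⟩ := exists_smul_eq_mk_rep L v hv
  refine (mk_eq_mk_iff' L _ _ _ _).2 ⟨(c : L) ^ q, ?_⟩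
  ext i
  rw [← hc]
  simp [Units.smul_def, mul_pow, h]

theorem frobP1_optionToP1 {q : ℕ} (hq : q ≠ 0) (z : Option L) :
    frobP1 q (optionToP1 z) = optionToP1 (z.map (· ^ q)) := by
  cases z <;> exact frobP1_mk q _ _ fun i => by fin_cases i <;> simp [hq]

theorem frobP1_iterate_optionToP1 {q : ℕ} (hq : q ≠ 0) (n : ℕ) (z : Option L) :
    (frobP1 q)^[n] (optionToP1 z) = optionToP1 (z.map (· ^ q ^ n)) := by
  induction n with
  | zero => cases z <;> simp
  | succ n ih =>
    rw [Function.iterate_succ_apply', ih, frobP1_optionToP1 hq, Option.map_map]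
    congr 2
    ext a
    simp [pow_succ, pow_mul]

/-- The `n`-th power of the `q`-Frobenius has `q ^ n + 1` fixed points on the projective line. -/
theorem ncard_fixedPoints_frobP1_iterate [IsAlgClosed L] (p : ℕ) [CharP L p] {q n : ℕ}
    (hq : 1 < q) (hp : p ∣ q) (hn : n ≠ 0) :
    (Function.fixedPoints (frobP1 (L := L) q)^[n]).ncard = q ^ n + 1 := by
  have hm : 1 < q ^ n := Nat.one_lt_pow hn hq
  have hcard := ncard_setOf_pow_eq_self (L := L) p hm (hp.trans (dvd_pow_self q hn))
  have hset : Function.fixedPoints (frobP1 (L := L) q)^[n] =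
      optionToP1 '' (insert none (some '' {a : L | a ^ q ^ n = a})) := by
    ext x
    obtain ⟨z, rfl⟩ := optionToP1_bijective.2 x
    rw [optionToP1_bijective.1.mem_set_image, Function.mem_fixedPoints, Function.IsFixedPt,
      frobP1_iterate_optionToP1 (by lia), optionToP1_bijective.1.eq_iff]
    cases z <;> simp
  rw [hset, Set.ncard_image_of_injective _ optionToP1_bijective.1,
    Set.ncard_insert_of_notMem (by simp)
      ((Set.finite_of_ncard_ne_zero (by lia)).image _),
    Set.ncard_image_of_injective _ (Option.some_injective L), hcard]

end FrobeniusPoints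

/-- An injective quadruple consisting of a 3-cycle of `f` followed by a fixed point is determined
by a point of exact period 3 and a fixed point. -/
def threeCycleFixedPointEquiv {α : Type*} (f : α → α) :
    {x : Fin 4 → α // Function.Injective x ∧
      f (x 0) = x 1 ∧ f (x 1) = x 2 ∧ f (x 2) = x 0 ∧ f (x 3) = x 3} ≃
    ↥((Function.fixedPoints f^[3] \ Function.fixedPoints f) ×ˢ Function.fixedPoints f) where
  toFun x := ⟨(x.1 0, x.1 3), by
    obtain ⟨x, hx, h0, h1, h2, h3⟩ := x
    refine ⟨⟨?_, fun h => ?_⟩, h3⟩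
    · simp [Function.IsFixedPt, h0, h1, h2]
    · exact absurd (hx (h0.symm.trans h)) (by decide)⟩
  invFun y := ⟨![y.1.1, f y.1.1, f (f y.1.1), y.1.2], by
    obtain ⟨⟨a, b⟩, ⟨ha, ha'⟩, hb⟩ := y
    replace ha : f (f (f a)) = a := ha
    replace ha' : f a ≠ a := ha'
    replace hb : f b = b := hb
    refine ⟨fun i j hij => ?_, rfl, rfl, ha, hb⟩
    fin_cases i <;> fin_cases j <;> simp at hij ⊢ <;> grind⟩
  left_inv x := by
    obtain ⟨x, hx, h0, h1, h2, h3⟩ := x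
    ext i
    fin_cases i <;> simp [h0, h1]
  right_inv y := rfl

/-- the number of injective 4-tuples of points of `P¹(K̄)`
satisfying the stated Frobenius conditions. -/
theorem statement17 (q : ℕ) (hq : IsPrimePow q)
    (K : Type*) [Field K] [Fintype K] (hK : Fintype.card K = q) :
    (Nat.card
      {x : Fin 4 → Projectivization (AlgebraicClosure K) (Fin 2 → AlgebraicClosure K) //
        Function.Injective x ∧
        frobP1 q (x 0) = x 1 ∧
        frobP1 q (x 1) = x 2 ∧
        frobP1 q (x 2) = x 0 ∧
        frobP1 q (x 3) = x 3} : ℤ)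
    = ((q : ℤ) + 1) * ((q : ℤ) ^ 3 - (q : ℤ)) := by
  obtain ⟨p, hp⟩ := CharP.exists K
  have hpq : p ∣ q := (CharP.cast_eq_zero_iff K p q).1 (by rw [← hK, FiniteField.cast_card_eq_zero])
  have : CharP (AlgebraicClosure K) p := charP_of_injective_algebraMap' K p
  have h1 := ncard_fixedPoints_frobP1_iterate (L := AlgebraicClosure K) p hq.one_lt hpq one_ne_zero
  have h3 := ncard_fixedPoints_frobP1_iterate (L := AlgebraicClosure K) p hq.one_lt hpq
    three_ne_zero
  rw [Function.iterate_one, pow_one] at h1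
  have hsub : Function.fixedPoints (frobP1 (L := AlgebraicClosure K) q) ⊆
      Function.fixedPoints (frobP1 q)^[3] := fun x hx => Function.IsFixedPt.iterate hx 3
  have hdiff := Set.ncard_sdiff_add_ncard_of_subset hsub (Set.finite_of_ncard_ne_zero (by lia))
  rw [Nat.card_congr (threeCycleFixedPointEquiv (frobP1 q)), Nat.card_coe_set_eq,
    Set.ncard_prod, h1]
  rw [h1, h3] at hdiff
  zify at hdiff
  push_cast
  linear_combination ((q : ℤ) + 1) * hdiff
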